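/- In the setting of the operator T of the previous statement (GME model setting with (C1), f differentiable with Lipschitz gradient, nonempty solution set, and the stated subdifferential calculus rules), let L_𝔡 > 0 be a Lipschitz constant of ∇𝔡, set ρ := 1/max{L_𝔡, μ‖B‖²_op}, and choose σ > 0 and τ > 1/(2ρ) satisfying σ > μ‖𝔏*𝔏 + ℭ*ℭ‖_op + (2ρμ²‖B*B𝔏‖²_op + τ)/(2ρτ − 1). Then: (i) the self-adjoint operator 𝔓 on H := X×Z×Z×𝔷 defined blockwise by 𝔓(x,v,w,z) := (σx − μ𝔏*B*Bv − μ𝔏*w − μℭ*z, −μB*B𝔏x + τv, −μ𝔏x + μw, −μℭx + μz) is positive definite; (ii) θ := (σ + τ − μ‖𝔏*𝔏 + ℭ*ℭ‖_op)/(ρ(στ − τμ‖𝔏*𝔏 + ℭ*ℭ‖_op − μ²‖B*B𝔏‖²_op)) satisfies θ < 2; and (iii) T is 2/(4−θ)-averaged nonexpansive with respect to the inner product ⟨h, h'⟩_𝔓 := ⟨𝔓h, h'⟩, i.e. there is a map R : H → H with ⟨𝔓(Rh₁ − Rh₂), Rh₁ − Rh₂⟩ ≤ ⟨𝔓(h₁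 − h₂), h₁ − h₂⟩ for all h₁, h₂ ∈ H such that T = (1 − α)Id + αR with α = 2/(4−θ). -/

import Mathlib

open scoped Pointwise RealInnerProductSpace

noncomputable section

/-- Convexity for extended-real-valued functions. -/
def EConvex {H : Type*} [AddCommGroup H] [Module ℝ H] (φ : H → EReal) : Prop :=
  ∀ (x y : H) (a b : ℝ), 0 ≤ a → 0 ≤ b → a + b = 1 →
    φ (a • x + b • y) ≤ (a : EReal) * φ x + (b : EReal) * φ y

/-- Coercivity (`φ u → ∞` as `‖u‖ → ∞`) for extended-real-valued functions. -/
def ECoercive {H : Type*} [NormedAddCommGroup H] (φ : H → EReal) : Prop :=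
  ∀ C : ℝ, ∃ R : ℝ, ∀ x : H, R ≤ ‖x‖ → (C : EReal) ≤ φ x

/-- Legendre–Fenchel conjugate `φ*(y) = sup_v (⟨v, y⟩ − φ(v))`. -/
noncomputable def fenchel {H : Type*} [NormedAddCommGroup H] [InnerProductSpace ℝ H]
    (φ : H → EReal) (y : H) : EReal :=
  ⨆ v : H, ((⟪v, y⟫ : ℝ) : EReal) - φ v

/-- Generalized Moreau enhanced function `Ψ_B(z) = Ψ(z) − inf_v [Ψ(v) + (1/2)‖B(z−v)‖²]`. -/
noncomputable def GME {Z Z' : Type*} [NormedAddCommGroup Z] [InnerProductSpace ℝ Z]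
    [NormedAddCommGroup Z'] [InnerProductSpace ℝ Z']
    (Ψ : Z → EReal) (B : Z →ₗ[ℝ] Z') (z : Z) : EReal :=
  Ψ z - ⨅ v : Z, (Ψ v + ((((1 : ℝ) / 2) * ‖B (z - v)‖ ^ 2 : ℝ) : EReal))

/-- The cost function `J(x) = f(Ax) + μ Ψ_B(𝔏x)`. -/
noncomputable def Jcost {X Y Z Z' : Type*}
    [NormedAddCommGroup X] [InnerProductSpace ℝ X]
    [NormedAddCommGroup Y] [InnerProductSpace ℝ Y]
    [NormedAddCommGroup Z] [InnerProductSpace ℝ Z]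
    [NormedAddCommGroup Z'] [InnerProductSpace ℝ Z']
    (A : X →ₗ[ℝ] Y) (Lm : X →ₗ[ℝ] Z) (B : Z →ₗ[ℝ] Z')
    (f : Y → ℝ) (Ψ : Z → EReal) (μ : ℝ) (x : X) : EReal :=
  ((f (A x) : ℝ) : EReal) + (μ : EReal) * GME Ψ B (Lm x)

/-- Subdifferential of an extended-real-valued function. -/
def esubdiff {H : Type*} [NormedAddCommGroup H] [InnerProductSpace ℝ H]
    (φ : H → EReal) (x : H) : Set H :=
  {u : H | ∀ y : H, φ x + ((⟪y - x, u⟫ : ℝ) : EReal) ≤ φ y}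

-- Indicator function `ι_Δ` of a set (0 on Δ, ∞ outside).
open Classical in
noncomputable def eindicator {W : Type*} (Δ : Set W) (p : W) : EReal :=
  if p ∈ Δ then 0 else ⊤

/-- The operator `T` of the proposed algorithm. -/
noncomputable def Tmap {X Z Z' W : Type*}
    [NormedAddCommGroup X] [InnerProductSpace ℝ X] [FiniteDimensional ℝ X]
    [NormedAddCommGroup Z] [InnerProductSpace ℝ Z] [FiniteDimensional ℝ Z]
    [NormedAddCommGroup Z'] [InnerProductSpace ℝ Z'] [FiniteDimensional ℝ Z']
    [NormedAddCommGroup W] [InnerProductSpace ℝ W] [FiniteDimensional ℝ W]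
    (Lm : X →ₗ[ℝ] Z) (B : Z →ₗ[ℝ] Z') (Cm : X →ₗ[ℝ] W)
    (grad𝔡 : X → X) (prox1 prox2 : Z → Z) (PΔ : W → W) (μ σ τ : ℝ)
    (h : X × Z × Z × W) : X × Z × Z × W :=
  let x := h.1
  let v := h.2.1
  let w := h.2.2.1
  let z := h.2.2.2
  let ξ := x - (1 / σ) • grad𝔡 x
      - (μ / σ) • (LinearMap.adjoint Lm) ((LinearMap.adjoint B) (B v))
      - (μ / σ) • (LinearMap.adjoint Lm) w - (μ / σ) • (LinearMap.adjoint Cm) z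
  let ζ := prox1 ((2 * μ / τ) • (LinearMap.adjoint B) (B (Lm ξ))
      - (μ / τ) • (LinearMap.adjoint B) (B (Lm x))
      + (v - (μ / τ) • (LinearMap.adjoint B) (B v)))
  let η := prox2 ((2 : ℝ) • Lm ξ - Lm x + w)
  let ς := ((2 : ℝ) • Cm ξ - Cm x + z) - PΔ ((2 : ℝ) • Cm ξ - Cm x + z)
  (ξ, ζ, η, ς)

/-- The operator `𝔓` defining the metric of the algorithm. -/
noncomputable def Pmap {X Z Z' W : Type*}
    [NormedAddCommGroup X] [InnerProductSpace ℝ X] [FiniteDimensional ℝ X]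
    [NormedAddCommGroup Z] [InnerProductSpace ℝ Z] [FiniteDimensional ℝ Z]
    [NormedAddCommGroup Z'] [InnerProductSpace ℝ Z'] [FiniteDimensional ℝ Z']
    [NormedAddCommGroup W] [InnerProductSpace ℝ W] [FiniteDimensional ℝ W]
    (Lm : X →ₗ[ℝ] Z) (B : Z →ₗ[ℝ] Z') (Cm : X →ₗ[ℝ] W) (μ σ τ : ℝ)
    (h : X × Z × Z × W) : X × Z × Z × W :=
  (σ • h.1 - μ • (LinearMap.adjoint Lm) ((LinearMap.adjoint B) (B h.2.1))
      - μ • (LinearMap.adjoint Lm) h.2.2.1 - μ • (LinearMap.adjoint Cm) h.2.2.2,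
   τ • h.2.1 - μ • (LinearMap.adjoint B) (B (Lm h.1)),
   μ • h.2.2.1 - μ • Lm h.1,
   μ • h.2.2.2 - μ • Cm h.1)

/-- The canonical inner product on the product space `X × Z × Z × W`. -/
noncomputable def pInner {X Z W : Type*}
    [NormedAddCommGroup X] [InnerProductSpace ℝ X]
    [NormedAddCommGroup Z] [InnerProductSpace ℝ Z]
    [NormedAddCommGroup W] [InnerProductSpace ℝ W]
    (h h' : X × Z × Z × W) : ℝ :=
  ⟪h.1, h'.1⟫ + ⟪h.2.1, h'.2.1⟫ + ⟪h.2.2.1, h'.2.2.1⟫ + ⟪h.2.2.2, h'.2.2.2⟫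

section Convex

variable {E : Type*} [NormedAddCommGroup E] [InnerProductSpace ℝ E]

/-- Variational inequality characterising a proximal point. -/
theorem ConvexOn.le_add_inner_of_prox {D : Set E} {g : E → ℝ} (hg : ConvexOn ℝ D g)
    {u p y : E} (hp : p ∈ D) (hy : y ∈ D)
    (hmin : ∀ y ∈ D, g p + 1 / 2 * ‖p - u‖ ^ 2 ≤ g y + 1 / 2 * ‖y - u‖ ^ 2) :
    g p ≤ g y + ⟪p - u, y - p⟫ := by
  have key : ∀ t : ℝ, 0 < t → t ≤ 1 →
      g p ≤ g y + ⟪p - u, y - p⟫ + t * (1 / 2 * ‖y - p‖ ^ 2) := by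
    intro t ht ht1
    have h1 := hmin _ (hg.1 hp hy (sub_nonneg.2 ht1) ht.le (by ring))
    have h2 := hg.2 hp hy (sub_nonneg.2 ht1) ht.le (by ring)
    have h3 : (1 - t) • p + t • y - u = (p - u) + t • (y - p) := by module
    rw [h3, norm_add_sq_real, norm_smul, inner_smul_right, mul_pow, Real.norm_eq_abs,
      sq_abs] at h1
    simp only [smul_eq_mul] at h2
    have h4 : t * g p ≤ t * (g y + ⟪p - u, y - p⟫ + t * (1 / 2 * ‖y - p‖ ^ 2)) := by
      linarith
    exact le_of_mul_le_mul_left h4 ht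
  by_contra! hlt
  set a := 1 / 2 * ‖y - p‖ ^ 2
  have ha : 0 ≤ a := by positivity
  set d := g p - (g y + ⟪p - u, y - p⟫) with hd
  have hd0 : 0 < d := sub_pos.2 hlt
  have hpos : 0 < d + a + 1 := by linarith
  have h := key (d / (d + a + 1)) (by positivity) ((div_le_one hpos).2 (by linarith))
  have h' : d / (d + a + 1) * a < d := by
    rw [div_mul_eq_mul_div, div_lt_iff₀ hpos]
    nlinarith
  linarith

/-- Proximal maps of convex functions are firmly nonexpansive. -/
theorem ConvexOn.inner_prox_sub_prox_nonneg {D : Set E} {g : E → ℝ} (hg : ConvexOn ℝ D g)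
    {u v p q : E} (hp : p ∈ D) (hq : q ∈ D)
    (hpmin : ∀ y ∈ D, g p + 1 / 2 * ‖p - u‖ ^ 2 ≤ g y + 1 / 2 * ‖y - u‖ ^ 2)
    (hqmin : ∀ y ∈ D, g q + 1 / 2 * ‖q - v‖ ^ 2 ≤ g y + 1 / 2 * ‖y - v‖ ^ 2) :
    0 ≤ ⟪p - q, (u - v) - (p - q)⟫ := by
  have h1 := hg.le_add_inner_of_prox hp hq hpmin
  have h2 := hg.le_add_inner_of_prox hq hp hqmin
  have h3 : ⟪p - q, (u - v) - (p - q)⟫ = ⟪p - u, q - p⟫ + ⟪q - v, p - q⟫ := by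
    have h4 : (u - v) - (p - q) = (q - v) - (p - u) := by abel
    rw [h4, ← neg_sub p q, inner_neg_right, inner_sub_right, real_inner_comm (q - v),
      real_inner_comm (p - u)]
    ring
  linarith

variable [CompleteSpace E]

theorem HasGradientAt.hasDerivAt_line {g : E → ℝ} {a h : E} {t : ℝ} {G : E}
    (hg : HasGradientAt g G (a + t • h)) :
    HasDerivAt (fun s : ℝ => g (a + s • h)) ⟪G, h⟫ t := by
  have hl : HasDerivAt (fun s : ℝ => a + s • h) h t := by
    simpa using ((hasDerivAt_id t).smul_const h).const_add a
  exact hg.hasFDerivAt.comp_hasDerivAt t hl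

theorem ConvexOn.add_inner_gradient_le {g : E → ℝ} (hg : ConvexOn ℝ Set.univ g)
    (hd : Differentiable ℝ g) (x y : E) :
    g x + ⟪gradient g x, y - x⟫ ≤ g y := by
  have hconv : ConvexOn ℝ Set.univ (fun t : ℝ => g (x + t • (y - x))) := by
    have h := hg.comp_affineMap (AffineMap.lineMap x y : ℝ →ᵃ[ℝ] E)
    refine h.congr fun t _ => ?_
    simp [AffineMap.lineMap_apply, add_comm]
  have hder : HasDerivAt (fun t : ℝ => g (x + t • (y - x))) ⟪gradient g x, y - x⟫ 0 :=
    HasGradientAt.hasDerivAt_line (by simpa using (hd x).hasGradientAt)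
  have h := hconv.le_slope_of_hasDerivAt (Set.mem_univ 0) (Set.mem_univ 1) one_pos hder
  simp only [slope_def_field, one_smul, zero_smul, add_zero, add_sub_cancel, sub_zero,
    div_one] at h
  linarith

/-- The descent lemma. -/
theorem le_add_inner_gradient_add_of_lipschitz {g : E → ℝ} (hd : Differentiable ℝ g) {L : ℝ}
    (hL : ∀ x y, ‖gradient g x - gradient g y‖ ≤ L * ‖x - y‖) (x h : E) :
    g (x + h) ≤ g x + ⟪gradient g x, h⟫ + L / 2 * ‖h‖ ^ 2 := by
  let φ : ℝ → ℝ := fun t =>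
    t * ⟪gradient g x, h⟫ + t ^ 2 * (L / 2 * ‖h‖ ^ 2) - g (x + t • h)
  have hφ : ∀ t, HasDerivAt φ
      (⟪gradient g x, h⟫ + 2 * t * (L / 2 * ‖h‖ ^ 2) - ⟪gradient g (x + t • h), h⟫) t := by
    intro t
    have h1 := (hasDerivAt_id t).mul_const ⟪gradient g x, h⟫
    have h2 := (hasDerivAt_pow 2 t).mul_const (L / 2 * ‖h‖ ^ 2)
    have h3 := HasGradientAt.hasDerivAt_line (hd (x + t • h)).hasGradientAt
    exact ((h1.add h2).sub h3).congr_deriv (by norm_num)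
  have hmono : MonotoneOn φ (Set.Ici 0) := by
    refine monotoneOn_of_deriv_nonneg (convex_Ici 0)
      (fun t _ => (hφ t).continuousAt.continuousWithinAt)
      (fun t _ => (hφ t).differentiableAt.differentiableWithinAt) fun t ht => ?_
    rw [interior_Ici] at ht
    have ht : 0 < t := ht
    rw [(hφ t).deriv]
    have h1 := real_inner_le_norm (gradient g (x + t • h) - gradient g x) h
    have h2 := hL (x + t • h) x
    rw [add_sub_cancel_left, norm_smul, Real.norm_of_nonneg ht.le] at h2
    have h3 := mul_le_mul_of_nonneg_right h2 (norm_nonneg h)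
    rw [inner_sub_left] at h1
    nlinarith
  have h := hmono (Set.mem_Ici.2 le_rfl) (Set.mem_Ici.2 zero_le_one) zero_le_one
  simp only [φ, zero_smul, one_smul, add_zero] at h
  linarith

/-- The Baillon–Haddad theorem: an `L`-Lipschitz gradient of a convex function is
`1 / L`-cocoercive. -/
theorem ConvexOn.gradient_cocoercive {g : E → ℝ} (hg : ConvexOn ℝ Set.univ g)
    (hd : Differentiable ℝ g) {L : ℝ} (hLpos : 0 < L)
    (hL : ∀ x y, ‖gradient g x - gradient g y‖ ≤ L * ‖x - y‖) (x y : E) :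
    1 / L * ‖gradient g x - gradient g y‖ ^ 2 ≤ ⟪gradient g x - gradient g y, x - y⟫ := by
  have key : ∀ x y : E, g x + ⟪gradient g x, y - x⟫
      + 1 / (2 * L) * ‖gradient g x - gradient g y‖ ^ 2 ≤ g y := by
    intro x y
    set D := gradient g x - gradient g y with hD
    have h1 := hg.add_inner_gradient_le hd x (y + (1 / L) • D)
    have h2 := le_add_inner_gradient_add_of_lipschitz hd hL y ((1 / L) • D)
    rw [norm_smul, mul_pow, Real.norm_eq_abs, sq_abs, inner_smul_right] at h2
    have h3 : y + (1 / L) • D - x = (y - x) + (1 / L) • D := by abel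
    rw [h3, inner_add_right, inner_smul_right] at h1
    have h4 : 1 / L * ⟪gradient g x, D⟫ - 1 / L * ⟪gradient g y, D⟫ = 1 / L * ‖D‖ ^ 2 := by
      rw [← mul_sub, ← inner_sub_left, ← hD, real_inner_self_eq_norm_sq]
    have h5 : L / 2 * ((1 / L) ^ 2 * ‖D‖ ^ 2) = 1 / (2 * L) * ‖D‖ ^ 2 := by
      field_simp
    have h6 : 1 / L * ‖D‖ ^ 2 = 2 * (1 / (2 * L) * ‖D‖ ^ 2) := by
      field_simp
    linarith
  have h1 := key x y
  have h2 := key y x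
  rw [norm_sub_rev (gradient g y)] at h2
  have h3 : ⟪gradient g x - gradient g y, x - y⟫
      = -⟪gradient g x, y - x⟫ - ⟪gradient g y, x - y⟫ := by
    rw [inner_sub_left, ← neg_sub y x, inner_neg_right, inner_neg_right]
  have h6 : 1 / L * ‖gradient g x - gradient g y‖ ^ 2
      = 2 * (1 / (2 * L) * ‖gradient g x - gradient g y‖ ^ 2) := by
    field_simp
  linarith

end Convex

section EReal

theorem EConvex.convexOn_toReal {H : Type*} [AddCommGroup H] [Module ℝ H] {φ : H → EReal}
    (hφ : EConvex φ) (hbot : ∀ x, φ x ≠ ⊥) :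
    ConvexOn ℝ {x | φ x ≠ ⊤} (fun x => (φ x).toReal) := by
  have key : ∀ x, φ x ≠ ⊤ → ∀ y, φ y ≠ ⊤ → ∀ a b : ℝ, 0 ≤ a → 0 ≤ b → a + b = 1 →
      φ (a • x + b • y) ≤ ((a * (φ x).toReal + b * (φ y).toReal : ℝ) : EReal) := by
    intro x hx y hy a b ha hb hab
    rw [EReal.coe_add, EReal.coe_mul, EReal.coe_mul, EReal.coe_toReal hx (hbot x),
      EReal.coe_toReal hy (hbot y)]
    exact hφ x y a b ha hb hab
  refine ⟨fun x hx y hy a b ha hb hab => ?_, fun x hx y hy a b ha hb hab => ?_⟩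
  · exact ((key x hx y hy a b ha hb hab).trans_lt (EReal.coe_lt_top _)).ne
  · exact EReal.toReal_le_toReal (key x hx y hy a b ha hb hab) (hbot _)
      (EReal.coe_ne_top _)

theorem EReal.exists_real_le_of_coercive {H : Type*} [NormedAddCommGroup H] [ProperSpace H]
    {φ : H → EReal} (hbot : ∀ x, φ x ≠ ⊥) (hlsc : LowerSemicontinuous φ)
    (hcoer : ECoercive φ) : ∃ m : ℝ, ∀ x, (m : EReal) ≤ φ x := by
  obtain ⟨R, hR⟩ := hcoer 0
  rcases (Metric.closedBall (0 : H) R).eq_empty_or_nonempty with he | hne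
  · refine ⟨0, fun x => hR x ?_⟩
    by_contra! hx
    have : x ∈ Metric.closedBall (0 : H) R := by simpa using hx.le
    simp [he] at this
  obtain ⟨x₀, -, hx₀⟩ := LowerSemicontinuousOn.exists_isMinOn hne
    (isCompact_closedBall (0 : H) R) (hlsc.lowerSemicontinuousOn _)
  obtain ⟨c, hc⟩ : ∃ c : ℝ, (c : EReal) ≤ φ x₀ :=
    (EReal.lt_iff_exists_real_btwn.1 (bot_lt_iff_ne_bot.2 (hbot x₀))).imp fun _ h => h.2.le
  refine ⟨min c 0, fun x => ?_⟩
  rcases le_total R ‖x‖ with hx | hx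
  · exact (EReal.coe_le_coe_iff.2 (min_le_right _ _)).trans (hR x hx)
  · exact (EReal.coe_le_coe_iff.2 (min_le_left _ _)).trans
      (hc.trans (isMinOn_iff.1 hx₀ x (by simpa using hx)))

variable {H : Type*} [NormedAddCommGroup H] [InnerProductSpace ℝ H] {φ : H → EReal}

theorem eConvex_fenchel (hbot : ∀ x, φ x ≠ ⊥) : EConvex (fenchel φ) := by
  intro x y a b ha hb hab
  refine iSup_le fun v => ?_
  by_cases hv : φ v = ⊤
  · simp [hv]
  have hle : ∀ w, ((⟪v, w⟫ - (φ v).toReal : ℝ) : EReal) ≤ fenchel φ w := by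
    intro w
    rw [EReal.coe_sub, EReal.coe_toReal hv (hbot v)]
    exact le_iSup (fun v => ((⟪v, w⟫ : ℝ) : EReal) - φ v) v
  have heq : ((⟪v, a • x + b • y⟫ : ℝ) : EReal) - φ v
      = (a : EReal) * ((⟪v, x⟫ - (φ v).toReal : ℝ) : EReal)
        + (b : EReal) * ((⟪v, y⟫ - (φ v).toReal : ℝ) : EReal) := by
    rw [← EReal.coe_toReal hv (hbot v), EReal.toReal_coe]
    norm_cast
    rw [inner_add_right, inner_smul_right, inner_smul_right]
    linear_combination (-(φ v).toReal) * hab.symm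
  rw [heq]
  exact add_le_add (mul_le_mul_of_nonneg_left (hle x) (by exact_mod_cast ha))
    (mul_le_mul_of_nonneg_left (hle y) (by exact_mod_cast hb))

theorem fenchel_ne_bot (hbot : ∀ x, φ x ≠ ⊥) {v : H} (hv : φ v ≠ ⊤) (y : H) :
    fenchel φ y ≠ ⊥ := by
  have h := le_iSup (fun v => ((⟪v, y⟫ : ℝ) : EReal) - φ v) v
  rw [← EReal.coe_toReal hv (hbot v), ← EReal.coe_sub] at h
  exact ((EReal.bot_lt_coe _).trans_le h).ne'

theorem fenchel_zero_ne_top {m : ℝ} (hm : ∀ x, (m : EReal) ≤ φ x) : fenchel φ 0 ≠ ⊤ := by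
  have h : fenchel φ 0 ≤ ((-m : ℝ) : EReal) := by
    refine iSup_le fun v => ?_
    simpa using hm v
  exact (h.trans_lt (EReal.coe_lt_top _)).ne

/-- Firm nonexpansiveness of the proximal map of `c • φ` for an extended-real-valued convex
function `φ`. -/
theorem EConvex.inner_prox_sub_prox_nonneg (hφ : EConvex φ) (hbot : ∀ x, φ x ≠ ⊥)
    {x₀ : H} (hx₀ : φ x₀ ≠ ⊤) {c : ℝ} (hc : 0 < c) {prox : H → H}
    (hprox : ∀ u y : H, (c : EReal) * φ (prox u)
        + ((((1 : ℝ) / 2) * ‖prox u - u‖ ^ 2 : ℝ) : EReal)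
      ≤ (c : EReal) * φ y + ((((1 : ℝ) / 2) * ‖y - u‖ ^ 2 : ℝ) : EReal)) (u v : H) :
    0 ≤ ⟪prox u - prox v, (u - v) - (prox u - prox v)⟫ := by
  have hfin : ∀ u, φ (prox u) ≠ ⊤ := by
    intro u htop
    have h := hprox u x₀
    rw [htop, EReal.coe_mul_top_of_pos hc, EReal.top_add_coe,
      ← EReal.coe_toReal hx₀ (hbot x₀), ← EReal.coe_mul, ← EReal.coe_add] at h
    exact EReal.coe_ne_top _ (top_le_iff.1 h)
  have hmin : ∀ u, ∀ y ∈ {x | φ x ≠ ⊤},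
      c * (φ (prox u)).toReal + 1 / 2 * ‖prox u - u‖ ^ 2
        ≤ c * (φ y).toReal + 1 / 2 * ‖y - u‖ ^ 2 := by
    intro u y hy
    have h := hprox u y
    rw [← EReal.coe_toReal hy (hbot y), ← EReal.coe_toReal (hfin u) (hbot _)] at h
    exact_mod_cast h
  have hconv := (hφ.convexOn_toReal hbot).smul hc.le
  exact hconv.inner_prox_sub_prox_nonneg (hfin u) (hfin v) (hmin u) (hmin v)

end EReal

section Metric

variable {X Z Z' W : Type*}
  [NormedAddCommGroup X] [InnerProductSpace ℝ X] [FiniteDimensional ℝ X]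
  [NormedAddCommGroup Z] [InnerProductSpace ℝ Z] [FiniteDimensional ℝ Z]
  [NormedAddCommGroup Z'] [InnerProductSpace ℝ Z'] [FiniteDimensional ℝ Z']
  [NormedAddCommGroup W] [InnerProductSpace ℝ W] [FiniteDimensional ℝ W]
  (Lm : X →ₗ[ℝ] Z) (B : Z →ₗ[ℝ] Z') (Cm : X →ₗ[ℝ] W) (μ σ τ : ℝ)

theorem pInner_Pmap (h h' : X × Z × Z × W) :
    pInner (Pmap Lm B Cm μ σ τ h) h' =
      σ * ⟪h.1, h'.1⟫ + τ * ⟪h.2.1, h'.2.1⟫ + μ * ⟪h.2.2.1, h'.2.2.1⟫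
        + μ * ⟪h.2.2.2, h'.2.2.2⟫
        - μ * (⟪B h.2.1, B (Lm h'.1)⟫ + ⟪B (Lm h.1), B h'.2.1⟫)
        - μ * (⟪h.2.2.1, Lm h'.1⟫ + ⟪Lm h.1, h'.2.2.1⟫)
        - μ * (⟪h.2.2.2, Cm h'.1⟫ + ⟪Cm h.1, h'.2.2.2⟫) := by
  simp only [pInner, Pmap, inner_sub_left, real_inner_smul_left, LinearMap.adjoint_inner_left]
  ring

theorem pInner_Pmap_symm (h h' : X × Z × Z × W) :
    pInner (Pmap Lm B Cm μ σ τ h) h' = pInner h (Pmap Lm B Cm μ σ τ h') := by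
  have hc : pInner h (Pmap Lm B Cm μ σ τ h') = pInner (Pmap Lm B Cm μ σ τ h') h := by
    simp only [pInner, real_inner_comm]
  rw [hc, pInner_Pmap, pInner_Pmap]
  simp only [real_inner_comm h'.1, real_inner_comm h'.2.1, real_inner_comm h'.2.2.1,
    real_inner_comm h'.2.2.2, real_inner_comm (Lm h'.1), real_inner_comm (Cm h'.1),
    real_inner_comm (B (Lm h'.1)), real_inner_comm (B h'.2.1)]
  ring

theorem pInner_Pmap_sub_smul (d e : X × Z × Z × W) (c : ℝ) :
    pInner (Pmap Lm B Cm μ σ τ (d - c • e)) (d - c • e) =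
      pInner (Pmap Lm B Cm μ σ τ d) d - 2 * c * pInner (Pmap Lm B Cm μ σ τ e) d
        + c ^ 2 * pInner (Pmap Lm B Cm μ σ τ e) e := by
  have hs : pInner (Pmap Lm B Cm μ σ τ d) e = pInner (Pmap Lm B Cm μ σ τ e) d := by
    rw [pInner_Pmap_symm]
    simp only [pInner, real_inner_comm]
  have hexp : pInner (Pmap Lm B Cm μ σ τ (d - c • e)) (d - c • e) =
      pInner (Pmap Lm B Cm μ σ τ d) d - c * pInner (Pmap Lm B Cm μ σ τ e) d
        - c * pInner (Pmap Lm B Cm μ σ τ d) e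
        + c ^ 2 * pInner (Pmap Lm B Cm μ σ τ e) e := by
    simp only [pInner_Pmap, Prod.fst_sub, Prod.snd_sub, Prod.smul_fst, Prod.smul_snd, map_sub,
      map_smul, inner_sub_left, inner_sub_right, real_inner_smul_left, real_inner_smul_right]
    ring
  rw [hexp, hs]
  ring

theorem norm_sq_add_norm_sq_le (x : X) :
    ‖Lm x‖ ^ 2 + ‖Cm x‖ ^ 2 ≤
      ‖LinearMap.toContinuousLinearMap
        (LinearMap.adjoint Lm ∘ₗ Lm + LinearMap.adjoint Cm ∘ₗ Cm)‖ * ‖x‖ ^ 2 := by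
  set N := LinearMap.toContinuousLinearMap
    (LinearMap.adjoint Lm ∘ₗ Lm + LinearMap.adjoint Cm ∘ₗ Cm) with hN
  have h : ⟪N x, x⟫ = ‖Lm x‖ ^ 2 + ‖Cm x‖ ^ 2 := by
    simp [hN, inner_add_left, LinearMap.adjoint_inner_left]
  rw [← h]
  calc ⟪N x, x⟫ ≤ ‖N x‖ * ‖x‖ := real_inner_le_norm _ _
    _ ≤ ‖N‖ * ‖x‖ * ‖x‖ := by gcongr; exact N.le_opNorm x
    _ = _ := by ring

variable {μ τ}

/-- Completing squares in the last two blocks bounds `𝔓` below by a `2 × 2` quadratic form. -/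
theorem le_pInner_Pmap (hμ : 0 ≤ μ) (h : X × Z × Z × W) :
    (σ - μ * ‖LinearMap.toContinuousLinearMap
        (LinearMap.adjoint Lm ∘ₗ Lm + LinearMap.adjoint Cm ∘ₗ Cm)‖) * ‖h.1‖ ^ 2
      - 2 * (μ * ‖LinearMap.toContinuousLinearMap (LinearMap.adjoint B ∘ₗ B ∘ₗ Lm)‖)
        * ‖h.1‖ * ‖h.2.1‖
      + τ * ‖h.2.1‖ ^ 2 + μ * ‖h.2.2.1 - Lm h.1‖ ^ 2 + μ * ‖h.2.2.2 - Cm h.1‖ ^ 2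
      ≤ pInner (Pmap Lm B Cm μ σ τ h) h := by
  obtain ⟨x, v, w, z⟩ := h
  have h1 := mul_le_mul_of_nonneg_left (norm_sq_add_norm_sq_le Lm Cm x) hμ
  have h2 : ⟪B (Lm x), B v⟫ ≤
      ‖LinearMap.toContinuousLinearMap (LinearMap.adjoint B ∘ₗ B ∘ₗ Lm)‖ * ‖x‖ * ‖v‖ := by
    set M := LinearMap.toContinuousLinearMap (LinearMap.adjoint B ∘ₗ B ∘ₗ Lm) with hM
    have h : ⟪B (Lm x), B v⟫ = ⟪M x, v⟫ := by
      simp [hM, LinearMap.adjoint_inner_left]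
    rw [h]
    exact (real_inner_le_norm _ _).trans (by gcongr; exact M.le_opNorm x)
  have h2' := mul_le_mul_of_nonneg_left h2 hμ
  rw [pInner_Pmap]
  simp only [real_inner_self_eq_norm_sq, norm_sub_sq_real, real_inner_comm (Lm x) w,
    real_inner_comm (Cm x) z, real_inner_comm (B (Lm x)) (B v)]
  linarith

end Metric

/-- The smallest eigenvalue of a positive `2 × 2` matrix is at least determinant over trace. -/
theorem det_mul_le_trace_mul_quadratic (s t b p q : ℝ) :
    (s * t - b ^ 2) * (p ^ 2 + q ^ 2) ≤
      (s + t) * (s * p ^ 2 - 2 * b * p * q + t * q ^ 2) := by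
  nlinarith [sq_nonneg (s * p - b * q), sq_nonneg (b * p - t * q)]

section Operator

variable {X Z Z' W : Type*}
  [NormedAddCommGroup X] [InnerProductSpace ℝ X] [FiniteDimensional ℝ X]
  [NormedAddCommGroup Z] [InnerProductSpace ℝ Z] [FiniteDimensional ℝ Z]
  [NormedAddCommGroup Z'] [InnerProductSpace ℝ Z'] [FiniteDimensional ℝ Z']
  [NormedAddCommGroup W] [InnerProductSpace ℝ W] [FiniteDimensional ℝ W]
  {Lm : X →ₗ[ℝ] Z} {B : Z →ₗ[ℝ] Z'} {Cm : X →ₗ[ℝ] W} {μ σ τ : ℝ}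

/-- Monotonicity of the resolvent part of `T`, in the metric of `𝔓`. -/
theorem le_pInner_Pmap_sub_Tmap (hμ : 0 ≤ μ) (hσ : 0 < σ) (hτ : 0 < τ) {grad : X → X}
    {prox1 prox2 : Z → Z} {PΔ : W → W}
    (hprox1 : ∀ u v, 0 ≤ ⟪prox1 u - prox1 v, (u - v) - (prox1 u - prox1 v)⟫)
    (hprox2 : ∀ u v, 0 ≤ ⟪prox2 u - prox2 v, (u - v) - (prox2 u - prox2 v)⟫)
    (hPΔ : ∀ u v, 0 ≤ ⟪PΔ u - PΔ v, (u - v) - (PΔ u - PΔ v)⟫)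
    (h₁ h₂ : X × Z × Z × W) {d : X × Z × Z × W}
    (hd : d = Tmap Lm B Cm grad prox1 prox2 PΔ μ σ τ h₁
      - Tmap Lm B Cm grad prox1 prox2 PΔ μ σ τ h₂) :
    ⟪grad h₁.1 - grad h₂.1, d.1⟫ + μ * ⟪B (h₁.2.1 - h₂.2.1), B d.2.1⟫ ≤
      pInner (Pmap Lm B Cm μ σ τ (h₁ - h₂ - d)) d := by
  obtain ⟨x₁, v₁, w₁, z₁⟩ := h₁
  obtain ⟨x₂, v₂, w₂, z₂⟩ := h₂
  obtain ⟨ξ, ζ, η, ς⟩ := d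
  simp only [Tmap, Prod.mk_sub_mk, Prod.mk.injEq] at hd
  obtain ⟨hξ, hζ, hη, hς⟩ := hd
  set g := grad x₁ - grad x₂ with hg
  set x := x₁ - x₂ with hx
  set v := v₁ - v₂ with hv
  set w := w₁ - w₂ with hw
  set z := z₁ - z₂ with hz
  generalize hξ₁ : x₁ - (1 / σ) • grad x₁
      - (μ / σ) • (LinearMap.adjoint Lm) ((LinearMap.adjoint B) (B v₁))
      - (μ / σ) • (LinearMap.adjoint Lm) w₁ - (μ / σ) • (LinearMap.adjoint Cm) z₁ = ξ₁ at *
  generalize hξ₂ : x₂ - (1 / σ) • grad x₂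
      - (μ / σ) • (LinearMap.adjoint Lm) ((LinearMap.adjoint B) (B v₂))
      - (μ / σ) • (LinearMap.adjoint Lm) w₂ - (μ / σ) • (LinearMap.adjoint Cm) z₂ = ξ₂ at *
  have e1 : σ * ⟪ξ, ξ⟫ = σ * ⟪x, ξ⟫ - ⟪g, ξ⟫ - μ * ⟪B v, B (Lm ξ)⟫ - μ * ⟪w, Lm ξ⟫
      - μ * ⟪z, Cm ξ⟫ := by
    have h : σ • ξ = σ • x - g - μ • (LinearMap.adjoint Lm) ((LinearMap.adjoint B) (B v))
        - μ • (LinearMap.adjoint Lm) w - μ • (LinearMap.adjoint Cm) z := by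
      rw [hξ, ← hξ₁, ← hξ₂, hx, hg, hv, hw, hz]
      simp only [map_sub]
      match_scalars <;> field_simp
    have h' := congrArg (fun y => ⟪y, ξ⟫) h
    simpa only [inner_sub_left, real_inner_smul_left, LinearMap.adjoint_inner_left] using h'
  have e2 : 0 ≤ 2 * μ * ⟪B (Lm ξ), B ζ⟫ - μ * ⟪B (Lm x), B ζ⟫ + τ * ⟪v, ζ⟫
      - μ * ⟪B v, B ζ⟫ - τ * ⟪ζ, ζ⟫ := by
    have h := mul_nonneg hτ.le (hprox1
      ((2 * μ / τ) • (LinearMap.adjoint B) (B (Lm ξ₁))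
        - (μ / τ) • (LinearMap.adjoint B) (B (Lm x₁))
        + (v₁ - (μ / τ) • (LinearMap.adjoint B) (B v₁)))
      ((2 * μ / τ) • (LinearMap.adjoint B) (B (Lm ξ₂))
        - (μ / τ) • (LinearMap.adjoint B) (B (Lm x₂))
        + (v₂ - (μ / τ) • (LinearMap.adjoint B) (B v₂))))
    rw [← hζ, real_inner_comm, ← real_inner_smul_left] at h
    have h' : τ • ((2 * μ / τ) • (LinearMap.adjoint B) (B (Lm ξ₁))
        - (μ / τ) • (LinearMap.adjoint B) (B (Lm x₁))
        + (v₁ - (μ / τ) • (LinearMap.adjoint B) (B v₁))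
      - ((2 * μ / τ) • (LinearMap.adjoint B) (B (Lm ξ₂))
        - (μ / τ) • (LinearMap.adjoint B) (B (Lm x₂))
        + (v₂ - (μ / τ) • (LinearMap.adjoint B) (B v₂))) - ζ)
        = (2 * μ) • (LinearMap.adjoint B) (B (Lm ξ)) - μ • (LinearMap.adjoint B) (B (Lm x))
          + τ • v - μ • (LinearMap.adjoint B) (B v) - τ • ζ := by
      rw [hξ, hx, hv]
      simp only [map_sub]
      match_scalars <;> field_simp
    rw [h'] at h
    simpa only [inner_sub_left, inner_add_left, real_inner_smul_left,
      LinearMap.adjoint_inner_left] using h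
  have e3 : 0 ≤ 2 * ⟪Lm ξ, η⟫ - ⟪Lm x, η⟫ + ⟪w, η⟫ - ⟪η, η⟫ := by
    have h := hprox2 ((2 : ℝ) • Lm ξ₁ - Lm x₁ + w₁) ((2 : ℝ) • Lm ξ₂ - Lm x₂ + w₂)
    rw [← hη, real_inner_comm] at h
    have h' : (2 : ℝ) • Lm ξ₁ - Lm x₁ + w₁ - ((2 : ℝ) • Lm ξ₂ - Lm x₂ + w₂) - η
        = (2 : ℝ) • Lm ξ - Lm x + w - η := by
      rw [hξ, hx, hw]
      simp only [map_sub]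
      module
    rw [h'] at h
    simpa only [inner_sub_left, inner_add_left, real_inner_smul_left] using h
  have e4 : 0 ≤ 2 * ⟪Cm ξ, ς⟫ - ⟪Cm x, ς⟫ + ⟪z, ς⟫ - ⟪ς, ς⟫ := by
    have h := hPΔ ((2 : ℝ) • Cm ξ₁ - Cm x₁ + z₁) ((2 : ℝ) • Cm ξ₂ - Cm x₂ + z₂)
    have h' : (2 : ℝ) • Cm ξ₁ - Cm x₁ + z₁ - ((2 : ℝ) • Cm ξ₂ - Cm x₂ + z₂)
        = (2 : ℝ) • Cm ξ - Cm x + z := by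
      rw [hξ, hx, hz]
      simp only [map_sub]
      module
    have h'' : PΔ ((2 : ℝ) • Cm ξ₁ - Cm x₁ + z₁) - PΔ ((2 : ℝ) • Cm ξ₂ - Cm x₂ + z₂)
        = (2 : ℝ) • Cm ξ - Cm x + z - ς := by
      rw [hς, ← h']
      abel
    rw [h', h'', sub_sub_cancel, real_inner_comm, inner_sub_right, real_inner_comm] at h
    simpa only [inner_sub_left, inner_add_left, real_inner_smul_left] using h
  have e3' := mul_nonneg hμ e3
  have e4' := mul_nonneg hμ e4
  rw [pInner_Pmap]
  clear_value x v w z g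
  simp only [Prod.mk_sub_mk, ← hx, ← hv, ← hw, ← hz, map_sub, inner_sub_left]
  rw [real_inner_comm (Lm ξ) η, real_inner_comm (Cm ξ) ς, real_inner_comm (B (Lm ξ)) (B ζ)]
  linarith

end Operator

/-- The forward part `(∇𝔡, μ B* B)` of `T` is `ρ`-cocoercive, so that its inner product with a
perturbed increment is bounded below. -/
theorem neg_norm_sq_le_forward {E Z Z' : Type*}
    [NormedAddCommGroup E] [InnerProductSpace ℝ E]
    [NormedAddCommGroup Z] [InnerProductSpace ℝ Z] [FiniteDimensional ℝ Z]
    [NormedAddCommGroup Z'] [InnerProductSpace ℝ Z'] [FiniteDimensional ℝ Z']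
    {B : Z →ₗ[ℝ] Z'} {μ ρ : ℝ} (hρ : 0 < ρ) (hμ : 0 ≤ μ)
    (hρB : ρ * (μ * ‖LinearMap.toContinuousLinearMap B‖ ^ 2) ≤ 1) {g x e : E} {v k : Z}
    (hg : ρ * ‖g‖ ^ 2 ≤ ⟪g, x⟫) :
    -(‖e‖ ^ 2 + ‖k‖ ^ 2) ≤ 4 * ρ * (⟪g, x - e⟫ + μ * ⟪B v, B (v - k)⟫) := by
  set b := μ • (LinearMap.adjoint B) (B v) with hb
  have hnorm : ‖(LinearMap.adjoint B) (B v)‖ ≤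
      ‖LinearMap.toContinuousLinearMap B‖ * ‖B v‖ := by
    have h1 : ‖(LinearMap.adjoint B) (B v)‖ ^ 2 ≤
        ‖LinearMap.toContinuousLinearMap B‖ * ‖B v‖ * ‖(LinearMap.adjoint B) (B v)‖ := by
      rw [← real_inner_self_eq_norm_sq, LinearMap.adjoint_inner_left]
      have h2 := real_inner_le_norm (B v) (B ((LinearMap.adjoint B) (B v)))
      have h3 := (LinearMap.toContinuousLinearMap B).le_opNorm ((LinearMap.adjoint B) (B v))
      have h4 := mul_le_mul_of_nonneg_left h3 (norm_nonneg (B v))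
      rw [LinearMap.coe_toContinuousLinearMap'] at h4
      linarith
    rcases (norm_nonneg ((LinearMap.adjoint B) (B v))).eq_or_lt with h | h
    · rw [← h]; positivity
    · rw [sq] at h1
      exact le_of_mul_le_mul_right h1 h
  have hcoc : ρ * ‖b‖ ^ 2 ≤ μ * ‖B v‖ ^ 2 := by
    have h1 := pow_le_pow_left₀ (norm_nonneg _) hnorm 2
    have h2 : ‖b‖ ^ 2 = μ ^ 2 * ‖(LinearMap.adjoint B) (B v)‖ ^ 2 := by
      rw [hb, norm_smul, mul_pow, Real.norm_eq_abs, sq_abs]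
    rw [h2]
    calc ρ * (μ ^ 2 * ‖(LinearMap.adjoint B) (B v)‖ ^ 2)
        ≤ ρ * (μ ^ 2 * (‖LinearMap.toContinuousLinearMap B‖ * ‖B v‖) ^ 2) := by gcongr
      _ = ρ * (μ * ‖LinearMap.toContinuousLinearMap B‖ ^ 2) * (μ * ‖B v‖ ^ 2) := by ring
      _ ≤ 1 * (μ * ‖B v‖ ^ 2) := by gcongr
      _ = _ := one_mul _
  have hbk : μ * ⟪B v, B k⟫ = ⟪b, k⟫ := by
    rw [hb, real_inner_smul_left, LinearMap.adjoint_inner_left]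
  have s1 : 0 ≤ ‖(2 * ρ) • g - e‖ ^ 2 := by positivity
  have s2 : 0 ≤ ‖(2 * ρ) • b - k‖ ^ 2 := by positivity
  rw [norm_sub_sq_real, norm_smul, real_inner_smul_left, mul_pow, Real.norm_eq_abs,
    sq_abs] at s1 s2
  rw [map_sub, inner_sub_right, inner_sub_right, real_inner_self_eq_norm_sq, mul_sub, hbk]
  have t1 := mul_le_mul_of_nonneg_left hg hρ.le
  have t2 := mul_le_mul_of_nonneg_left hcoc hρ.le
  nlinarith

theorem stmt18
    {X Y Z Z' W : Type*}
    [NormedAddCommGroup X] [InnerProductSpace ℝ X] [FiniteDimensional ℝ X]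
    [NormedAddCommGroup Y] [InnerProductSpace ℝ Y] [FiniteDimensional ℝ Y]
    [NormedAddCommGroup Z] [InnerProductSpace ℝ Z] [FiniteDimensional ℝ Z]
    [NormedAddCommGroup Z'] [InnerProductSpace ℝ Z'] [FiniteDimensional ℝ Z']
    [NormedAddCommGroup W] [InnerProductSpace ℝ W] [FiniteDimensional ℝ W]
    (A : X →ₗ[ℝ] Y) (Lm : X →ₗ[ℝ] Z) (B : Z →ₗ[ℝ] Z') (Cm : X →ₗ[ℝ] W)
    (f : Y → ℝ) (hf : ConvexOn ℝ Set.univ f)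
    (Ψ : Z → EReal) (hΨbot : ∀ z : Z, Ψ z ≠ ⊥) (hΨlsc : LowerSemicontinuous Ψ)
    (hΨconv : EConvex Ψ) (hΨcoer : ECoercive Ψ)
    (μ : ℝ) (hμ : 0 < μ)
    (Δ : Set W) (hΔne : Δ.Nonempty) (hΔcl : IsClosed Δ) (hΔcv : Convex ℝ Δ)
    (hfeas : ∃ x : X, Ψ (Lm x) ≠ ⊤ ∧ Cm x ∈ Δ)
    (hC1 : ConvexOn ℝ Set.univ (fun x : X => f (A x) - μ / 2 * ‖B (Lm x)‖ ^ 2))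
    (hfdiff : Differentiable ℝ f) (Lf : ℝ) (hLf : 0 < Lf)
    (hflip : ∀ y₁ y₂ : Y, ‖gradient f y₁ - gradient f y₂‖ ≤ Lf * ‖y₁ - y₂‖)
    (hsol : ∃ xs : X, Cm xs ∈ Δ ∧
      ∀ x : X, Cm x ∈ Δ → Jcost A Lm B f Ψ μ xs ≤ Jcost A Lm B f Ψ μ x)
    (hsum : ∀ x : X,
      esubdiff (fun x' : X => Jcost A Lm B f Ψ μ x' + eindicator Δ (Cm x')) x
        = esubdiff (Jcost A Lm B f Ψ μ) x
          + esubdiff (fun x' : X => eindicator Δ (Cm x')) x)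
    (hchainΨ : ∀ x : X,
      esubdiff (fun x' : X => Ψ (Lm x')) x = LinearMap.adjoint Lm '' esubdiff Ψ (Lm x))
    (hchainΔ : ∀ x : X,
      esubdiff (fun x' : X => eindicator Δ (Cm x')) x
        = LinearMap.adjoint Cm '' esubdiff (eindicator Δ) (Cm x))
    (prox1 prox2 : Z → Z) (PΔ : W → W) (σ τ : ℝ)
    (hprox1 : ∀ u v' : Z,
      ((μ / τ : ℝ) : EReal) * Ψ (prox1 u)
          + ((((1 : ℝ) / 2) * ‖prox1 u - u‖ ^ 2 : ℝ) : EReal)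
        ≤ ((μ / τ : ℝ) : EReal) * Ψ v' + ((((1 : ℝ) / 2) * ‖v' - u‖ ^ 2 : ℝ) : EReal))
    (hprox2 : ∀ u w' : Z,
      fenchel Ψ (prox2 u) + ((((1 : ℝ) / 2) * ‖prox2 u - u‖ ^ 2 : ℝ) : EReal)
        ≤ fenchel Ψ w' + ((((1 : ℝ) / 2) * ‖w' - u‖ ^ 2 : ℝ) : EReal))
    (hPΔ : ∀ u : W, PΔ u ∈ Δ ∧ ∀ q ∈ Δ, ‖u - PΔ u‖ ≤ ‖u - q‖)
    (L𝔡 : ℝ) (hL𝔡pos : 0 < L𝔡)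
    (hL𝔡 : ∀ x y : X,
      ‖gradient (fun x'' : X => f (A x'') - μ / 2 * ‖B (Lm x'')‖ ^ 2) x
          - gradient (fun x'' : X => f (A x'') - μ / 2 * ‖B (Lm x'')‖ ^ 2) y‖
        ≤ L𝔡 * ‖x - y‖)
    (ρ : ℝ) (hρ : ρ = 1 / max L𝔡 (μ * ‖LinearMap.toContinuousLinearMap B‖ ^ 2))
    (nLC : ℝ) (hnLC : nLC =
      ‖LinearMap.toContinuousLinearMap
        (LinearMap.adjoint Lm ∘ₗ Lm + LinearMap.adjoint Cm ∘ₗ Cm)‖)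
    (nBBL : ℝ) (hnBBL : nBBL =
      ‖LinearMap.toContinuousLinearMap (LinearMap.adjoint B ∘ₗ B ∘ₗ Lm)‖)
    (hσ : 0 < σ) (hτ' : 1 / (2 * ρ) < τ)
    (hστ : μ * nLC + (2 * ρ * μ ^ 2 * nBBL ^ 2 + τ) / (2 * ρ * τ - 1) < σ)
    (θ : ℝ) (hθ : θ = (σ + τ - μ * nLC) / (ρ * (σ * τ - τ * μ * nLC - μ ^ 2 * nBBL ^ 2))) :
    (∀ h h' : X × Z × Z × W,
      pInner (Pmap Lm B Cm μ σ τ h) h' = pInner h (Pmap Lm B Cm μ σ τ h')) ∧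
    (∀ h : X × Z × Z × W, h ≠ 0 → 0 < pInner (Pmap Lm B Cm μ σ τ h) h) ∧
    θ < 2 ∧
    ∃ R : X × Z × Z × W → X × Z × Z × W,
      (∀ h₁ h₂ : X × Z × Z × W,
        pInner (Pmap Lm B Cm μ σ τ (R h₁ - R h₂)) (R h₁ - R h₂)
          ≤ pInner (Pmap Lm B Cm μ σ τ (h₁ - h₂)) (h₁ - h₂)) ∧
      ∀ h : X × Z × Z × W,
        Tmap Lm B Cm (gradient (fun x'' : X => f (A x'') - μ / 2 * ‖B (Lm x'')‖ ^ 2))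
            prox1 prox2 PΔ μ σ τ h
          = (1 - 2 / (4 - θ)) • h + (2 / (4 - θ)) • R h := by
  have hmax : 0 < max L𝔡 (μ * ‖LinearMap.toContinuousLinearMap B‖ ^ 2) :=
    lt_max_of_lt_left hL𝔡pos
  have hρpos : 0 < ρ := by rw [hρ]; positivity
  have hρL : ρ ≤ 1 / L𝔡 := by
    rw [hρ]
    exact one_div_le_one_div_of_le hL𝔡pos (le_max_left _ _)
  have hρB : ρ * (μ * ‖LinearMap.toContinuousLinearMap B‖ ^ 2) ≤ 1 := by
    rw [hρ, one_div_mul_eq_div]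
    exact (div_le_one hmax).2 (le_max_right _ _)
  have hτ : 0 < τ := lt_trans (by positivity) hτ'
  have hρτ : 0 < 2 * ρ * τ - 1 := by
    rw [div_lt_iff₀ (by positivity)] at hτ'
    linarith
  set s := σ - μ * nLC with hs
  set b := μ * nBBL with hb
  have hsb : 2 * ρ * b ^ 2 + τ < s * (2 * ρ * τ - 1) := by
    rw [← div_lt_iff₀ hρτ]
    have h : 2 * ρ * b ^ 2 + τ = 2 * ρ * μ ^ 2 * nBBL ^ 2 + τ := by rw [hb]; ring
    rw [h]
    linarith
  have hspos : 0 < s := pos_of_mul_pos_left (lt_trans (by positivity) hsb) hρτ.le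
  have hdet : 0 < s * τ - b ^ 2 := by
    have h : 0 < 2 * ρ * (s * τ - b ^ 2) := by linarith
    exact pos_of_mul_pos_right h (by positivity)
  have hθ' : θ = (s + τ) / (ρ * (s * τ - b ^ 2)) := by
    rw [hθ, hs, hb]
    congr 1 <;> ring
  have hθ2 : θ < 2 := by
    rw [hθ', div_lt_iff₀ (by positivity)]
    linarith
  have hquad : ∀ h : X × Z × Z × W,
      s * ‖h.1‖ ^ 2 - 2 * b * ‖h.1‖ * ‖h.2.1‖ + τ * ‖h.2.1‖ ^ 2
        + μ * ‖h.2.2.1 - Lm h.1‖ ^ 2 + μ * ‖h.2.2.2 - Cm h.1‖ ^ 2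
        ≤ pInner (Pmap Lm B Cm μ σ τ h) h := by
    intro h
    rw [hs, hb, hnLC, hnBBL]
    exact le_pInner_Pmap Lm B Cm σ hμ.le h
  have hblock : ∀ h : X × Z × Z × W, (s * τ - b ^ 2) * (‖h.1‖ ^ 2 + ‖h.2.1‖ ^ 2) ≤
      (s + τ) * (s * ‖h.1‖ ^ 2 - 2 * b * ‖h.1‖ * ‖h.2.1‖ + τ * ‖h.2.1‖ ^ 2) :=
    fun h => det_mul_le_trace_mul_quadratic s τ b ‖h.1‖ ‖h.2.1‖
  have hθq : ∀ h : X × Z × Z × W,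
      ‖h.1‖ ^ 2 + ‖h.2.1‖ ^ 2 ≤ θ * ρ * pInner (Pmap Lm B Cm μ σ τ h) h := by
    intro h
    have hθρ : θ * ρ = (s + τ) / (s * τ - b ^ 2) := by
      rw [hθ']
      field_simp
    have h3 : 0 ≤ μ * ‖h.2.2.1 - Lm h.1‖ ^ 2 := by positivity
    have h4 : 0 ≤ μ * ‖h.2.2.2 - Cm h.1‖ ^ 2 := by positivity
    rw [hθρ, div_mul_eq_mul_div, le_div_iff₀ hdet, mul_comm _ (s * τ - b ^ 2)]
    refine (hblock h).trans (mul_le_mul_of_nonneg_left ?_ (by positivity))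
    linarith [hquad h]
  refine ⟨pInner_Pmap_symm Lm B Cm μ σ τ, fun h hne => ?_, hθ2, ?_⟩
  · by_contra! hle
    have hzero : ‖h.1‖ ^ 2 + ‖h.2.1‖ ^ 2 ≤ 0 :=
      (hθq h).trans (mul_nonpos_of_nonneg_of_nonpos (by rw [hθ']; positivity) hle)
    have hx : h.1 = 0 := by
      have := sq_nonneg ‖h.2.1‖
      exact norm_eq_zero.1 (pow_eq_zero_iff two_ne_zero |>.1
        (le_antisymm (by linarith) (sq_nonneg ‖h.1‖)))
    have hv : h.2.1 = 0 := by
      have := sq_nonneg ‖h.1‖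
      exact norm_eq_zero.1 (pow_eq_zero_iff two_ne_zero |>.1
        (le_antisymm (by linarith) (sq_nonneg ‖h.2.1‖)))
    have hwz := (hquad h).trans hle
    simp only [hx, hv, map_zero, sub_zero, norm_zero] at hwz
    have hwz' : μ * (‖h.2.2.1‖ ^ 2 + ‖h.2.2.2‖ ^ 2) ≤ 0 := by linarith
    have hwz'' := nonpos_of_mul_nonpos_right hwz' hμ
    have hw : h.2.2.1 = 0 := by
      have := sq_nonneg ‖h.2.2.2‖
      exact norm_eq_zero.1 (pow_eq_zero_iff two_ne_zero |>.1
        (le_antisymm (by linarith) (sq_nonneg ‖h.2.2.1‖)))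
    have hz : h.2.2.2 = 0 := by
      have := sq_nonneg ‖h.2.2.1‖
      exact norm_eq_zero.1 (pow_eq_zero_iff two_ne_zero |>.1
        (le_antisymm (by linarith) (sq_nonneg ‖h.2.2.2‖)))
    exact hne (Prod.ext hx (Prod.ext hv (Prod.ext hw hz)))
  obtain ⟨x₀, hx₀, -⟩ := hfeas
  obtain ⟨m, hm⟩ := EReal.exists_real_le_of_coercive hΨbot hΨlsc hΨcoer
  have hfirm1 := hΨconv.inner_prox_sub_prox_nonneg hΨbot hx₀ (div_pos hμ hτ) hprox1
  have hfirm2 := (eConvex_fenchel hΨbot).inner_prox_sub_prox_nonneg (fenchel_ne_bot hΨbot hx₀)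
    (fenchel_zero_ne_top hm) one_pos (prox := prox2) (by simpa using hprox2)
  have hfirm3 : ∀ u v, 0 ≤ ⟪PΔ u - PΔ v, (u - v) - (PΔ u - PΔ v)⟫ := by
    have hmin : ∀ u, ∀ q ∈ Δ, (0 : ℝ) + 1 / 2 * ‖PΔ u - u‖ ^ 2 ≤ 0 + 1 / 2 * ‖q - u‖ ^ 2 := by
      intro u q hq
      have h := (hPΔ u).2 q hq
      rw [norm_sub_rev u, norm_sub_rev u] at h
      gcongr
    exact fun u v => (convexOn_const 0 hΔcv).inner_prox_sub_prox_nonneg (hPΔ u).1 (hPΔ v).1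
      (hmin u) (hmin v)
  have hdiff : Differentiable ℝ (fun x : X => f (A x) - μ / 2 * ‖B (Lm x)‖ ^ 2) := by
    have hA : Differentiable ℝ (fun x : X => A x) :=
      (LinearMap.toContinuousLinearMap A).differentiable
    have hBL : Differentiable ℝ (fun x : X => B (Lm x)) :=
      (LinearMap.toContinuousLinearMap (B ∘ₗ Lm)).differentiable
    exact (hfdiff.comp hA).sub ((hBL.norm_sq ℝ).const_mul _)
  have hcoc := hC1.gradient_cocoercive hdiff hL𝔡pos hL𝔡
  set T := Tmap Lm B Cm (gradient (fun x'' : X => f (A x'') - μ / 2 * ‖B (Lm x'')‖ ^ 2))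
    prox1 prox2 PΔ μ σ τ with hT
  have hc : 0 < 4 - θ := by linarith
  refine ⟨fun h => h - ((4 - θ) / 2) • (h - T h), fun h₁ h₂ => ?_, fun h => ?_⟩
  · have hR : h₁ - ((4 - θ) / 2) • (h₁ - T h₁) - (h₂ - ((4 - θ) / 2) • (h₂ - T h₂))
        = (h₁ - h₂) - ((4 - θ) / 2) • (h₁ - h₂ - (T h₁ - T h₂)) := by module
    have hres := le_pInner_Pmap_sub_Tmap hμ.le hσ hτ hfirm1 hfirm2 hfirm3 h₁ h₂
      (d := T h₁ - T h₂) rfl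
    have hfwd := neg_norm_sq_le_forward (B := B) hρpos hμ.le hρB
      (e := (h₁ - h₂ - (T h₁ - T h₂)).1) (v := h₁.2.1 - h₂.2.1)
      (k := (h₁ - h₂ - (T h₁ - T h₂)).2.1)
      ((mul_le_mul_of_nonneg_right hρL (sq_nonneg _)).trans (hcoc h₁.1 h₂.1))
    have hθe := hθq (h₁ - h₂ - (T h₁ - T h₂))
    have hdx : h₁.1 - h₂.1 - (h₁ - h₂ - (T h₁ - T h₂)).1 = (T h₁ - T h₂).1 := by simp
    have hdv : h₁.2.1 - h₂.2.1 - (h₁ - h₂ - (T h₁ - T h₂)).2.1 = (T h₁ - T h₂).2.1 := by simp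
    rw [hdx, hdv] at hfwd
    set e := h₁ - h₂ - (T h₁ - T h₂) with he
    have hsplit := pInner_Pmap_sub_smul Lm B Cm μ σ τ (h₁ - h₂) e ((4 - θ) / 2)
    have hdT : T h₁ - T h₂ = (h₁ - h₂) - e := by rw [he]; abel
    have hlin : pInner (Pmap Lm B Cm μ σ τ e) (T h₁ - T h₂)
        = pInner (Pmap Lm B Cm μ σ τ e) (h₁ - h₂) - pInner (Pmap Lm B Cm μ σ τ e) e := by
      rw [hdT]
      simp only [pInner, Prod.fst_sub, Prod.snd_sub, inner_sub_right]
      ring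
    have hkey : 0 ≤ θ * pInner (Pmap Lm B Cm μ σ τ e) e
        + 4 * pInner (Pmap Lm B Cm μ σ τ e) (T h₁ - T h₂) := by
      have hres' := mul_le_mul_of_nonneg_left hres (show 0 ≤ 4 * ρ by positivity)
      refine le_of_mul_le_mul_left (a := ρ) ?_ hρpos
      linarith
    rw [hR, hsplit]
    rw [hlin] at hkey
    have hkey' := mul_nonneg hc.le hkey
    linarith
  · have h1 : (2 / (4 - θ)) * ((4 - θ) / 2) = 1 := by field_simp
    rw [smul_sub, smul_smul, h1]
    module
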